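/- arXiv:2507.17272 — 2 statements merged into one kernel-verified Lean document; each statement's English description precedes it below -/
import Mathlib

section
/- Let C ⊆ ℝⁿ be a nonempty compact convex set with diameter diam(C), let f : ℝⁿ → ℝ be differentiable with ∇f L-Lipschitz continuous on C, and suppose f is star-convex on C. Let {x^k} ⊆ C and {p^k} ⊆ C be sequences generated by the Frank–Wolfe algorithm with the diminishing stepsize rule: for each k, p^k minimizes u ↦ ∇f(x^k)ᵀ(u − x^k) over C with optimal value ω_k := ∇f(x^k)ᵀ(p^k − x^k), and x^{k+1} = x^k + β_k(p^k − x^k) with β_k = 2/(k+2). Then for every constant L₀ ≥ 0 and every integer k ≥ 3, min{ |ω_ℓ| : ℓ ∈ {⌊k/2⌋+2, …, k} } ≤ 16(L + L₀)·diam(C)²/(k−2), where ⌊k/2⌋ is the greatest integer n with n ≤ k/2. -/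
open Set Metric
open scoped RealInnerProductSpace

lemma HasGradientAt.hasDerivAt_comp_line {E : Type*} [NormedAddCommGroup E]
    [InnerProductSpace ℝ E] [CompleteSpace E] {f : E → ℝ} {g x d : E} {t : ℝ}
    (hf : HasGradientAt f g (x + t • d)) :
    HasDerivAt (fun s : ℝ => f (x + s • d)) ⟪g, d⟫ t := by
  have h1 : HasDerivAt (fun s : ℝ => x + s • d) d t := by
    simpa using ((hasDerivAt_id t).smul_const d).const_add x
  exact (hf.hasFDerivAt.comp_hasDerivAt t h1).congr_deriv (by simp)

/-- The descent lemma on a convex set on which the gradient is Lipschitz. -/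
lemma Convex.le_add_inner_add_sq_of_gradient_lipschitz {E : Type*} [NormedAddCommGroup E]
    [InnerProductSpace ℝ E] [CompleteSpace E] {C : Set E} (hC : Convex ℝ C)
    {f : E → ℝ} {f' : E → E} (hf : ∀ x, HasGradientAt f (f' x) x) {L : ℝ}
    (hLip : ∀ x ∈ C, ∀ y ∈ C, ‖f' x - f' y‖ ≤ L * ‖x - y‖) {x d : E}
    (hx : x ∈ C) (hd : x + d ∈ C) :
    f (x + d) ≤ f x + ⟪f' x, d⟫ + L / 2 * ‖d‖ ^ 2 := by
  have hder : ∀ t : ℝ, HasDerivAt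
      (fun s : ℝ => f (x + s • d) - s * ⟪f' x, d⟫ - L / 2 * ‖d‖ ^ 2 * s ^ 2)
      (⟪f' (x + t • d), d⟫ - ⟪f' x, d⟫ - L * ‖d‖ ^ 2 * t) t := fun t => by
    have h := ((hf (x + t • d)).hasDerivAt_comp_line.sub
      ((hasDerivAt_id t).mul_const ⟪f' x, d⟫)).sub
      ((hasDerivAt_pow 2 t).const_mul (L / 2 * ‖d‖ ^ 2))
    refine h.congr_deriv ?_
    norm_num
    ring
  have hanti := antitoneOn_of_deriv_nonpos (convex_Icc (0 : ℝ) 1)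
    (fun t _ => (hder t).continuousAt.continuousWithinAt)
    (fun t _ => (hder t).differentiableAt.differentiableWithinAt) (fun t ht => by
      rw [interior_Icc] at ht
      rw [(hder t).deriv]
      have hmem : x + t • d ∈ C := hC.add_smul_mem hx hd ⟨ht.1.le, ht.2.le⟩
      have h1 := hLip _ hmem _ hx
      rw [add_sub_cancel_left, norm_smul, Real.norm_of_nonneg ht.1.le] at h1
      have h2 := real_inner_le_norm (f' (x + t • d) - f' x) d
      rw [inner_sub_left] at h2
      nlinarith [mul_le_mul_of_nonneg_right h1 (norm_nonneg d)])
  have h := hanti (left_mem_Icc.2 zero_le_one) (right_mem_Icc.2 zero_le_one) zero_le_one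
  norm_num at h
  linarith

/-- The gradient inequality at a point along which `f` lies below its chord towards `y`. -/
lemma HasGradientAt.inner_le_sub_of_le_chord {E : Type*} [NormedAddCommGroup E]
    [InnerProductSpace ℝ E] [CompleteSpace E] {f : E → ℝ} {g x y : E}
    (hf : HasGradientAt f g x)
    (h : ∀ l ∈ Icc (0 : ℝ) 1, f (l • y + (1 - l) • x) ≤ l * f y + (1 - l) * f x) :
    ⟪g, y - x⟫ ≤ f y - f x := by
  have hder : HasDerivAt (fun s : ℝ => f (x + s • (y - x))) ⟪g, y - x⟫ 0 :=
    HasGradientAt.hasDerivAt_comp_line (by simpa using hf)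
  have ht := hder.tendsto_slope_zero_right
  refine le_of_tendsto ht ?_
  filter_upwards [Ioo_mem_nhdsGT (zero_lt_one (α := ℝ))] with t ht
  have h1 := h t ⟨ht.1.le, ht.2.le⟩
  have h2 : t • y + (1 - t) • x = x + t • (y - x) := by module
  rw [h2] at h1
  simp only [zero_add, zero_smul, add_zero, smul_eq_mul]
  rw [inv_mul_le_iff₀ ht.1]
  linarith

/-- The `O(1 / k)` bound on a primal gap `h` dominated by the duality gap `g`. -/
lemma primal_gap_le_of_diminishing_step {h g : ℕ → ℝ} {M : ℝ} (hM : 0 ≤ M)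
    (hg : ∀ k, h k ≤ g k)
    (hrec : ∀ k : ℕ, h (k + 1) ≤ h k - 2 / ((k : ℝ) + 2) * g k
      + M / 2 * (2 / ((k : ℝ) + 2)) ^ 2) (k : ℕ) :
    h (k + 1) ≤ 2 * M / ((k : ℝ) + 3) := by
  induction k with
  | zero =>
    have h1 := hrec 0
    have h2 := hg 0
    norm_num at h1 ⊢
    linarith
  | succ k ih =>
    have h1 := hrec (k + 1)
    have h2 := hg (k + 1)
    push_cast at h1 ⊢
    have hk : (0 : ℝ) ≤ k := k.cast_nonneg
    have h3 : 2 / ((k : ℝ) + 1 + 2) * h (k + 1) ≤ 2 / ((k : ℝ) + 1 + 2) * g (k + 1) := by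
      gcongr
    have h4 : (1 - 2 / ((k : ℝ) + 1 + 2)) * h (k + 1)
        ≤ (1 - 2 / ((k : ℝ) + 1 + 2)) * (2 * M / ((k : ℝ) + 3)) := by
      refine mul_le_mul_of_nonneg_left ih ?_
      rw [sub_nonneg, div_le_one (by positivity)]
      linarith
    have h5 : 2 * M / ((k : ℝ) + 1 + 3) - ((1 - 2 / ((k : ℝ) + 1 + 2)) * (2 * M / ((k : ℝ) + 3))
        + M / 2 * (2 / ((k : ℝ) + 1 + 2)) ^ 2) = 2 * M / ((k + 4) * (k + 3) ^ 2) := by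
      field_simp
      ring
    have h6 : 0 ≤ 2 * M / (((k : ℝ) + 4) * (k + 3) ^ 2) := by positivity
    linarith

/-- Some duality gap in the second half of the first `k` iterations is `O(1 / k)`. -/
lemma exists_dual_gap_le_of_diminishing_step {h g : ℕ → ℝ} {M : ℝ} (hM : 0 ≤ M)
    (hnn : ∀ k, 0 ≤ h k) (hg : ∀ k, h k ≤ g k)
    (hrec : ∀ k : ℕ, h (k + 1) ≤ h k - 2 / ((k : ℝ) + 2) * g k
      + M / 2 * (2 / ((k : ℝ) + 2)) ^ 2) {k : ℕ} (hk : 3 ≤ k) :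
    ∃ l ∈ Finset.Icc (k / 2 + 2) k, g l ≤ 8 * M / ((k : ℝ) - 2) := by
  obtain ⟨l, hl, hmin⟩ := Finset.exists_min_image (Finset.Icc (k / 2 + 2) k) g
    ⟨k, Finset.mem_Icc.2 ⟨by omega, le_rfl⟩⟩
  refine ⟨l, hl, ?_⟩
  have hgl : 0 ≤ g l := (hnn l).trans (hg l)
  obtain ⟨q, hq⟩ : ∃ q, q = k / 2 := ⟨_, rfl⟩
  obtain ⟨N, hN⟩ : ∃ N, k + 1 = q + 2 + N := ⟨k + 1 - (q + 2), by omega⟩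
  rw [← hq] at hmin
  have hsum : ∀ j ≤ N, h (q + 2 + j) ≤ 2 * M / ((q : ℝ) + 4)
      + j * (2 * M / ((q : ℝ) + 4) ^ 2 - 2 / ((k : ℝ) + 2) * g l) := by
    intro j
    induction j with
    | zero =>
      intro _
      have h1 := primal_gap_le_of_diminishing_step hM hg hrec (q + 1)
      push_cast at h1 ⊢
      rw [show (q : ℝ) + 1 + 3 = q + 4 by ring] at h1
      simpa using h1
    | succ j ih =>
      intro hj
      have h0 := ih (by omega)
      have h1 := hrec (q + 2 + j)
      have h2 := hmin (q + 2 + j) (Finset.mem_Icc.2 ⟨by omega, by omega⟩)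
      have hle : ((q + 2 + j : ℕ) : ℝ) ≤ k := by exact_mod_cast (by omega : q + 2 + j ≤ k)
      have h3 : 2 / ((k : ℝ) + 2) * g l
          ≤ 2 / (((q + 2 + j : ℕ) : ℝ) + 2) * g (q + 2 + j) := by
        gcongr
      have h4 : M / 2 * (2 / (((q + 2 + j : ℕ) : ℝ) + 2)) ^ 2 ≤ M / 2 * (2 / ((q : ℝ) + 4)) ^ 2 := by
        have : (q : ℝ) + 4 ≤ ((q + 2 + j : ℕ) : ℝ) + 2 := by
          push_cast
          linarith [(j.cast_nonneg : (0 : ℝ) ≤ j)]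
        gcongr
      have h5 : M / 2 * (2 / ((q : ℝ) + 4)) ^ 2 = 2 * M / ((q : ℝ) + 4) ^ 2 := by
        field_simp
      rw [← add_assoc]
      push_cast
      linarith
  have hend := (hnn _).trans (hsum N le_rfl)
  have hNq : (N : ℝ) ≤ q + 4 := by exact_mod_cast (by omega : N ≤ q + 4)
  have hkq : (k : ℝ) ≤ 2 * q + 1 := by exact_mod_cast (by omega : k ≤ 2 * q + 1)
  have hkN : (k : ℝ) ≤ 2 * N + 2 := by exact_mod_cast (by omega : k ≤ 2 * N + 2)
  have hk3 : (3 : ℝ) ≤ k := by exact_mod_cast hk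
  have hq0 : (0 : ℝ) ≤ q := q.cast_nonneg
  have h1 : (N : ℝ) * (2 * M / ((q : ℝ) + 4) ^ 2) ≤ 2 * M / ((q : ℝ) + 4) := by
    calc (N : ℝ) * (2 * M / ((q : ℝ) + 4) ^ 2)
        ≤ ((q : ℝ) + 4) * (2 * M / ((q : ℝ) + 4) ^ 2) := by gcongr
      _ = 2 * M / ((q : ℝ) + 4) := by field_simp
  have h2 : 4 * M / ((q : ℝ) + 4) ≤ 8 * M / ((k : ℝ) + 2) := by
    rw [div_le_div_iff₀ (by positivity) (by positivity)]
    nlinarith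
  have h3 : 2 * (N * g l) / ((k : ℝ) + 2) ≤ 8 * M / ((k : ℝ) + 2) := by
    have e1 : 2 * (N * g l) / ((k : ℝ) + 2) = N * (2 / ((k : ℝ) + 2) * g l) := by ring
    have e2 : 4 * M / ((q : ℝ) + 4) = 2 * M / ((q : ℝ) + 4) + 2 * M / ((q : ℝ) + 4) := by ring
    linarith
  rw [div_le_div_iff_of_pos_right (by positivity)] at h3
  rw [le_div_iff₀ (by linarith)]
  nlinarith

/-- Iteration-complexity (duality gap) of the Frank–Wolfe algorithm with the
diminishing stepsize `β_k = 2/(k+2)` for a star-convex objective: for every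
`L₀ ≥ 0` and every `k ≥ 3`,
`min{ |ω_ℓ| : ℓ ∈ {⌊k/2⌋+2, …, k} } ≤ 16(L + L₀) diam(C)²/(k − 2)`. -/
theorem frank_wolfe_diminishing_rate_gap {n : ℕ}
    (C : Set (EuclideanSpace ℝ (Fin n)))
    (hCne : C.Nonempty) (hCcpt : IsCompact C) (hCcvx : Convex ℝ C)
    (f : EuclideanSpace ℝ (Fin n) → ℝ)
    (f' : EuclideanSpace ℝ (Fin n) → EuclideanSpace ℝ (Fin n))
    (hf : ∀ x, HasGradientAt f (f' x) x)
    (L : ℝ) (hL : 0 < L)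
    (hLip : ∀ x ∈ C, ∀ y ∈ C, ‖f' x - f' y‖ ≤ L * ‖x - y‖)
    (hne : ∃ xs ∈ C, ∀ y ∈ C, f xs ≤ f y)
    (hstar : ∀ xs ∈ C, (∀ y ∈ C, f xs ≤ f y) → ∀ x ∈ C, ∀ l ∈ Icc (0 : ℝ) 1,
      f (l • xs + (1 - l) • x) ≤ l * f xs + (1 - l) * f x)
    (x p : ℕ → EuclideanSpace ℝ (Fin n)) (ω : ℕ → ℝ)
    (hx : ∀ k, x k ∈ C) (hp : ∀ k, p k ∈ C)
    (hpmin : ∀ k, ∀ u ∈ C, ⟪f' (x k), p k - x k⟫ ≤ ⟪f' (x k), u - x k⟫)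
    (hωdef : ∀ k, ω k = ⟪f' (x k), p k - x k⟫)
    (hiter : ∀ k : ℕ, x (k + 1) = x k + (2 / ((k : ℝ) + 2)) • (p k - x k)) :
    ∀ L₀ : ℝ, 0 ≤ L₀ → ∀ k : ℕ, 3 ≤ k →
      ∃ ℓ ∈ Finset.Icc (k / 2 + 2) k,
        |ω ℓ| ≤ 16 * (L + L₀) * diam C ^ 2 / ((k : ℝ) - 2) := by
  intro L₀ hL₀ k hk
  obtain ⟨xs, hxs, hmin⟩ := hne
  have hD : ∀ k, ‖p k - x k‖ ≤ diam C := fun k => by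
    rw [← dist_eq_norm]
    exact dist_le_diam_of_mem hCcpt.isBounded (hp k) (hx k)
  have hgap : ∀ k, f (x k) - f xs ≤ -ω k := fun k => by
    have h1 := (hf (x k)).inner_le_sub_of_le_chord (hstar xs hxs hmin (x k) (hx k))
    have h2 := hpmin k xs hxs
    rw [hωdef]
    linarith
  obtain ⟨l, hl, hle⟩ := exists_dual_gap_le_of_diminishing_step
    (h := fun k => f (x k) - f xs) (g := fun k => -ω k) (M := L * diam C ^ 2) (by positivity)
    (fun k => sub_nonneg.2 (hmin _ (hx k))) hgap (fun k => by
      have h1 := hCcvx.le_add_inner_add_sq_of_gradient_lipschitz hf hLip (hx k)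
        (hiter k ▸ hx (k + 1))
      have h2 : ‖p k - x k‖ ^ 2 ≤ diam C ^ 2 := by
        gcongr
        exact hD k
      rw [← hiter, inner_smul_right, norm_smul, ← hωdef,
        Real.norm_of_nonneg (by positivity), mul_pow] at h1
      have h3 : L / 2 * ((2 / ((k : ℝ) + 2)) ^ 2 * ‖p k - x k‖ ^ 2)
          ≤ L / 2 * ((2 / ((k : ℝ) + 2)) ^ 2 * diam C ^ 2) := by gcongr
      linarith) hk
  refine ⟨l, hl, ?_⟩
  have hk3 : (3 : ℝ) ≤ k := by exact_mod_cast hk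
  have hω : ω l ≤ 0 := by linarith [hgap l, hmin _ (hx l)]
  rw [abs_of_nonpos hω]
  refine hle.trans (div_le_div_of_nonneg_right ?_ (by linarith))
  nlinarith [mul_nonneg hL.le (sq_nonneg (diam C)), mul_nonneg hL₀ (sq_nonneg (diam C))]
end

section
/- Let C ⊆ ℝⁿ be a nonempty compact convex set with diameter diam(C), let f : ℝⁿ → ℝ be differentiable with ∇f L-Lipschitz continuous on C, and suppose f is star-convex on C. Let {x^k} ⊆ C and {p^k} ⊆ C be sequences generated by the Frank–Wolfe algorithm with the Lipschitz-based stepsize rule: for each k, p^k minimizes u ↦ ∇f(x^k)ᵀ(u − x^k) over C with optimal value ω_k := ∇f(x^k)ᵀ(p^k − x^k) < 0, and x^{k+1} = x^k + λ_k(p^k − x^k) with λ_k = min{1, |ω_k|/(L·‖p^k − x^k‖²)}. Then for every constant L₀ ≥ 0 and every integer k ≥ 3, min{ |ω_ℓ| : ℓ ∈ {⌊k/2⌋+2, …, k} } ≤ 16(L + L₀)·diam(C)²/(k−2), where ⌊k/2⌋ is the greatest integer n with n ≤ k/2. -/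
open Set Metric
open scoped RealInnerProductSpace

section Auxiliary

variable {E : Type*} [NormedAddCommGroup E] [InnerProductSpace ℝ E] [CompleteSpace E]

lemma HasGradientAt.hasDerivAt_comp_add_smul {f : E → ℝ} {x d g : E} {s : ℝ}
    (h : HasGradientAt f g (x + s • d)) :
    HasDerivAt (fun t : ℝ => f (x + t • d)) ⟪g, d⟫ s := by
  have h1 : HasDerivAt (fun t : ℝ => x + t • d) d s := by
    simpa using ((hasDerivAt_id s).smul_const d).const_add x
  simpa [Function.comp_def] using h.hasFDerivAt.comp_hasDerivAt s h1

/-- The descent lemma for a gradient that is Lipschitz on a convex set. -/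
lemma le_add_inner_add_sq_of_gradient_lipschitzOn {C : Set E} (hC : Convex ℝ C)
    {f : E → ℝ} {f' : E → E} (hf : ∀ x, HasGradientAt f (f' x) x) {L : ℝ}
    (hLip : ∀ x ∈ C, ∀ y ∈ C, ‖f' x - f' y‖ ≤ L * ‖x - y‖)
    {x y : E} (hx : x ∈ C) (hy : y ∈ C) {t : ℝ} (ht : t ∈ Icc (0 : ℝ) 1) :
    f (x + t • (y - x)) ≤ f x + t * ⟪f' x, y - x⟫ + L * ‖y - x‖ ^ 2 * t ^ 2 / 2 := by
  set d := y - x with hd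
  have hderiv : ∀ s : ℝ, HasDerivAt
      (fun s : ℝ => f (x + s • d) - s * ⟪f' x, d⟫ - L * ‖d‖ ^ 2 * s ^ 2 / 2)
      (⟪f' (x + s • d), d⟫ - ⟪f' x, d⟫ - L * ‖d‖ ^ 2 * s) s := by
    intro s
    have h1 := (hf (x + s • d)).hasDerivAt_comp_add_smul
    have h2 := (hasDerivAt_id s).mul_const ⟪f' x, d⟫
    have h3 := (((hasDerivAt_id s).pow 2).const_mul (L * ‖d‖ ^ 2)).div_const 2
    refine ((h1.sub h2).sub h3).congr_deriv ?_
    simp only [id, Nat.cast_ofNat]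
    ring
  have hanti : AntitoneOn
      (fun s : ℝ => f (x + s • d) - s * ⟪f' x, d⟫ - L * ‖d‖ ^ 2 * s ^ 2 / 2)
      (Icc 0 1) := by
    refine antitoneOn_of_deriv_nonpos (convex_Icc 0 1)
      (fun s _ => (hderiv s).continuousAt.continuousWithinAt)
      (fun s _ => (hderiv s).differentiableAt.differentiableWithinAt) ?_
    intro s hs
    rw [interior_Icc] at hs
    rw [(hderiv s).deriv]
    have hmem : x + s • d ∈ C := hC.add_smul_sub_mem hx hy ⟨hs.1.le, hs.2.le⟩
    have h1 := hLip _ hmem x hx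
    rw [add_sub_cancel_left, norm_smul, Real.norm_of_nonneg hs.1.le] at h1
    have h2 := real_inner_le_norm (f' (x + s • d) - f' x) d
    rw [inner_sub_left] at h2
    nlinarith [mul_le_mul_of_nonneg_right h1 (norm_nonneg d)]
  have := hanti ⟨le_rfl, zero_le_one⟩ ht ht.1
  simp only [zero_smul, add_zero] at this
  linarith

/-- The gradient inequality towards a point with respect to which `f` is star-convex. -/
lemma inner_gradient_le_sub_of_star_convex {f : E → ℝ} {g x z : E}
    (hf : HasGradientAt f g x)
    (hstar : ∀ l ∈ Icc (0 : ℝ) 1, f (l • z + (1 - l) • x) ≤ l * f z + (1 - l) * f x) :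
    ⟪g, z - x⟫ ≤ f z - f x := by
  have h1 : HasDerivAt (fun t : ℝ => f (x + t • (z - x))) ⟪g, z - x⟫ 0 :=
    HasGradientAt.hasDerivAt_comp_add_smul (by simpa using hf)
  refine le_of_tendsto h1.tendsto_slope_zero_right ?_
  filter_upwards [Ioo_mem_nhdsGT (zero_lt_one' ℝ)] with t ht
  have h2 := hstar t ⟨ht.1.le, ht.2.le⟩
  rw [show t • z + (1 - t) • x = x + t • (z - x) by module] at h2
  simp only [zero_add, zero_smul, add_zero, smul_eq_mul]
  rw [inv_mul_le_iff₀ ht.1]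
  linarith

end Auxiliary

/-- The truncated step `min 1 (w / q)` minimizes the quadratic model over `[0, 1]`. -/
lemma quadratic_min_step_le {w q t : ℝ} (hq : 0 < q) (ht : t ≤ 1) :
    q * (min 1 (w / q)) ^ 2 / 2 - min 1 (w / q) * w ≤ q * t ^ 2 / 2 - t * w := by
  rcases le_total 1 (w / q) with h | h
  · rw [min_eq_left h]
    rw [le_div_iff₀ hq] at h
    nlinarith [mul_nonneg (sub_nonneg.2 ht) (sub_nonneg.2 h),
      mul_nonneg hq.le (sq_nonneg (1 - t))]
  · rw [min_eq_right h]
    have hwq : w = w / q * q := by field_simp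
    set s := w / q
    rw [hwq]
    nlinarith [mul_nonneg hq.le (sq_nonneg (t - s))]

/-- The `O(1/k)` rate for a sequence of primal gaps `h` with duality gaps `w`. -/
lemma primal_gap_rate {h w : ℕ → ℝ} {M : ℝ} (hM : 0 ≤ M) (hw : ∀ k, h k ≤ w k)
    (hstep : ∀ k, ∀ t ∈ Icc (0 : ℝ) 1, h (k + 1) ≤ h k - t * w k + M * t ^ 2 / 2) (k : ℕ) :
    h (k + 1) ≤ 2 * M / ((k : ℝ) + 4) := by
  induction k with
  | zero =>
    have := hstep 0 1 ⟨zero_le_one, le_rfl⟩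
    have := hw 0
    norm_num
    linarith
  | succ k ih =>
    have hk : (0 : ℝ) ≤ k := k.cast_nonneg
    have hk4 : (0 : ℝ) < (k : ℝ) + 4 := by linarith
    have ht1 : 2 / ((k : ℝ) + 4) ≤ 1 := by rw [div_le_one hk4]; linarith
    have ht0 : 0 ≤ 2 / ((k : ℝ) + 4) := by positivity
    have h1 := hstep (k + 1) _ ⟨ht0, ht1⟩
    have h2 := mul_le_mul_of_nonneg_left (hw (k + 1)) ht0
    have h3 := mul_le_mul_of_nonneg_left ih (sub_nonneg.2 ht1)
    have h4 : (1 - 2 / ((k : ℝ) + 4)) * (2 * M / ((k : ℝ) + 4)) + M * (2 / ((k : ℝ) + 4)) ^ 2 / 2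
        = 2 * M * ((k + 3) / ((k : ℝ) + 4) ^ 2) := by
      field_simp
      ring
    have h5 : ((k : ℝ) + 3) / ((k : ℝ) + 4) ^ 2 ≤ 1 / ((k : ℝ) + 5) := by
      rw [div_le_div_iff₀ (by positivity) (by positivity)]
      nlinarith
    have h6 := mul_le_mul_of_nonneg_left h5 (by positivity : 0 ≤ 2 * M)
    push_cast
    rw [show (k : ℝ) + 1 + 4 = k + 5 by ring, ← mul_one_div]
    linarith

/-- Some duality gap in the second half of the iterations is `O(1/k)`. -/
lemma exists_dual_gap_le {h w : ℕ → ℝ} {M : ℝ} (hM : 0 < M) (h0 : ∀ k, 0 ≤ h k)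
    (hw : ∀ k, h k ≤ w k)
    (hstep : ∀ k, ∀ t ∈ Icc (0 : ℝ) 1, h (k + 1) ≤ h k - t * w k + M * t ^ 2 / 2)
    {k : ℕ} (hk : 3 ≤ k) :
    ∃ l ∈ Finset.Icc (k / 2 + 2) k, w l ≤ 16 * M / ((k : ℝ) - 2) := by
  by_contra! hcon
  have hkR : (3 : ℝ) ≤ k := by exact_mod_cast hk
  have hc : (1 : ℝ) ≤ (k : ℝ) - 2 := by linarith
  set c : ℝ := (k : ℝ) - 2 with hcdef
  have hc0 : 0 < c := by linarith
  have hdec : ∀ j, k / 2 + 2 + j ≤ k + 1 →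
      h (k / 2 + 2 + j) ≤ h (k / 2 + 2) - j * (15 * M / c ^ 2) := by
    intro j
    induction j with
    | zero => intro _; simp
    | succ j ih =>
      intro hj
      have h1 := ih (by omega)
      have h2 := hcon (k / 2 + 2 + j) (Finset.mem_Icc.2 ⟨by omega, by omega⟩)
      have h3 := hstep (k / 2 + 2 + j) (1 / c)
        ⟨by positivity, by rw [div_le_one hc0]; exact hc⟩
      have h4 := mul_le_mul_of_nonneg_left h2.le (by positivity : 0 ≤ 1 / c)
      have h5 : 1 / c * (16 * M / c) - M * (1 / c) ^ 2 / 2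
          = 15 * M / c ^ 2 + M / c ^ 2 / 2 := by
        field_simp
        ring
      have h6 : 0 ≤ M / c ^ 2 := by positivity
      rw [← add_assoc]
      push_cast
      linarith
  have hlast := hdec (k - k / 2 - 1) (by omega)
  have hprimal := primal_gap_rate hM.le hw hstep (k / 2 + 1)
  have hlower := h0 (k / 2 + 2 + (k - k / 2 - 1))
  have hN : c / 2 ≤ ((k - k / 2 - 1 : ℕ) : ℝ) := by
    have : k ≤ 2 * (k - k / 2 - 1) + 2 := by omega
    have : (k : ℝ) ≤ 2 * ((k - k / 2 - 1 : ℕ) : ℝ) + 2 := by exact_mod_cast this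
    linarith
  have hm : c / 2 ≤ ((k / 2 + 1 : ℕ) : ℝ) + 4 := by
    have : k ≤ 2 * (k / 2 + 1) := by omega
    have : (k : ℝ) ≤ 2 * ((k / 2 + 1 : ℕ) : ℝ) := by exact_mod_cast this
    linarith
  have h1 : 2 * M / (((k / 2 + 1 : ℕ) : ℝ) + 4) ≤ 2 * M / (c / 2) := by gcongr
  have h2 := mul_le_mul_of_nonneg_right hN (by positivity : 0 ≤ 15 * M / c ^ 2)
  have h3 : c / 2 * (15 * M / c ^ 2) - 2 * M / (c / 2) = 7 / 2 * (M / c) := by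
    field_simp
    ring
  have h4 : 0 < M / c := by positivity
  rw [show k / 2 + 1 + 1 = k / 2 + 2 from rfl] at hprimal
  linarith

/-- Iteration-complexity (duality gap) of the Frank–Wolfe algorithm with the
Lipschitz-based stepsize `λ_k = min{1, |ω_k|/(L ‖p^k − x^k‖²)}` for a
star-convex objective: for every `L₀ ≥ 0` and every `k ≥ 3`,
`min{ |ω_ℓ| : ℓ ∈ {⌊k/2⌋+2, …, k} } ≤ 16(L + L₀) diam(C)²/(k − 2)`. -/
theorem frank_wolfe_lipschitz_rate_gap {n : ℕ}
    (C : Set (EuclideanSpace ℝ (Fin n)))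
    (hCne : C.Nonempty) (hCcpt : IsCompact C) (hCcvx : Convex ℝ C)
    (f : EuclideanSpace ℝ (Fin n) → ℝ)
    (f' : EuclideanSpace ℝ (Fin n) → EuclideanSpace ℝ (Fin n))
    (hf : ∀ x, HasGradientAt f (f' x) x)
    (L : ℝ) (hL : 0 < L)
    (hLip : ∀ x ∈ C, ∀ y ∈ C, ‖f' x - f' y‖ ≤ L * ‖x - y‖)
    (hne : ∃ xs ∈ C, ∀ y ∈ C, f xs ≤ f y)
    (hstar : ∀ xs ∈ C, (∀ y ∈ C, f xs ≤ f y) → ∀ x ∈ C, ∀ l ∈ Icc (0 : ℝ) 1,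
      f (l • xs + (1 - l) • x) ≤ l * f xs + (1 - l) * f x)
    (x p : ℕ → EuclideanSpace ℝ (Fin n)) (ω : ℕ → ℝ) (lam : ℕ → ℝ)
    (hx : ∀ k, x k ∈ C) (hp : ∀ k, p k ∈ C)
    (hpmin : ∀ k, ∀ u ∈ C, ⟪f' (x k), p k - x k⟫ ≤ ⟪f' (x k), u - x k⟫)
    (hωdef : ∀ k, ω k = ⟪f' (x k), p k - x k⟫) (hω : ∀ k, ω k < 0)
    (hlamdef : ∀ k, lam k = min 1 (|ω k| / (L * ‖p k - x k‖ ^ 2)))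
    (hiter : ∀ k : ℕ, x (k + 1) = x k + lam k • (p k - x k)) :
    ∀ L₀ : ℝ, 0 ≤ L₀ → ∀ k : ℕ, 3 ≤ k →
      ∃ ℓ ∈ Finset.Icc (k / 2 + 2) k,
        |ω ℓ| ≤ 16 * (L + L₀) * diam C ^ 2 / ((k : ℝ) - 2) := by
  intro L₀ hL₀ k hk
  obtain ⟨xs, hxs, hmin⟩ := hne
  have hd : ∀ j, 0 < ‖p j - x j‖ := by
    intro j
    rw [norm_pos_iff]
    intro h
    have := hω j
    rw [hωdef, h, inner_zero_right] at this
    exact lt_irrefl _ this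
  have hdiam : ∀ j, ‖p j - x j‖ ≤ diam C := fun j => by
    rw [← dist_eq_norm]
    exact dist_le_diam_of_mem hCcpt.isBounded (hp j) (hx j)
  have hD : 0 < diam C := (hd 0).trans_le (hdiam 0)
  obtain ⟨l, hl, hle⟩ := exists_dual_gap_le (h := fun j => f (x j) - f xs)
    (w := fun j => |ω j|) (M := L * diam C ^ 2) (by positivity)
    (fun j => sub_nonneg.2 (hmin _ (hx j)))
    (fun j => by
      have h1 := inner_gradient_le_sub_of_star_convex (hf (x j))
        (hstar xs hxs hmin (x j) (hx j))
      have h2 := hpmin j xs hxs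
      rw [← hωdef] at h2
      simp only [abs_of_neg (hω j)]
      linarith)
    (fun j t ht => by
      have hq : 0 < L * ‖p j - x j‖ ^ 2 := mul_pos hL (pow_pos (hd j) 2)
      have hlam : lam j ∈ Icc (0 : ℝ) 1 := by
        rw [hlamdef]
        exact ⟨le_min zero_le_one (div_nonneg (abs_nonneg _) hq.le), min_le_left _ _⟩
      have h1 := le_add_inner_add_sq_of_gradient_lipschitzOn hCcvx hf hLip (hx j) (hp j) hlam
      have h2 := quadratic_min_step_le (w := |ω j|) hq ht.2
      have h3 : L * ‖p j - x j‖ ^ 2 * t ^ 2 ≤ L * diam C ^ 2 * t ^ 2 := by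
        gcongr
        exact hdiam j
      rw [← hiter, ← hωdef] at h1
      rw [← hlamdef, abs_of_neg (hω j)] at h2
      simp only [abs_of_neg (hω j)]
      linarith)
    hk
  refine ⟨l, hl, hle.trans ?_⟩
  have hkR : (3 : ℝ) ≤ k := by exact_mod_cast hk
  have hnum : 16 * (L * diam C ^ 2) ≤ 16 * (L + L₀) * diam C ^ 2 := by
    nlinarith [mul_nonneg hL₀ (sq_nonneg (diam C))]
  exact div_le_div_of_nonneg_right hnum (by linarith)
end
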